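/- Let the sequences x_t ∈ ℝ^d and λ_t ∈ ℝ be generated by x_1 = 0, λ_1 = 0, x_{t+1} = Π_{(1−ξ)B}(x_t − η·g̃_{x,t}) and λ_{t+1} = max(0, λ_t + η·g̃_{λ,t}) for t = 1,…,T, where the update directions satisfy ‖g̃_{x,t} − ∇f_t(x_t)‖ ≤ G·d·λ_t and |g̃_{λ,t} + ηδλ_t| ≤ D for every t. Define the convex-concave surrogates H_t(x,λ) = L̂_t(x,λ) + ⟨g̃_{x,t} − ∇_x L̂_t(x_t,λ_t), x⟩ + (g̃_{λ,t} − ∇_λ L̂_t(x_t,λ_t))·λ, so that ∇_x H_t(x_t,λ_t) = g̃_{x,t} and ∇_λ H_t(x_t,λ_t) = g̃_{λ,t}. Then for every x ∈ (1−ξ)B and every λ ≥ 0: ∑_{t=1}^T (H_t(x_t, λ) − H_t(x, λ_t)) ≤ (R² + λ²)/(2η) + η(D² + G²)T + η(d²G² + η²δ²)∑_{t=1}^T λ_t². -/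

import Mathlib

open RealInnerProductSpace Finset

/-- `p` is the Euclidean (metric) projection of `y` onto the set `C`. -/
def IsProjOn {E : Type*} [NormedAddCommGroup E] (C : Set E) (y p : E) : Prop :=
  p ∈ C ∧ ∀ z ∈ C, ‖p - y‖ ≤ ‖z - y‖

/-- First-order characterization of convexity: a differentiable convex function lies above its
tangent hyperplanes. -/
theorem ConvexOn.inner_gradient_le_sub {E : Type*} [NormedAddCommGroup E] [InnerProductSpace ℝ E]
    [CompleteSpace E] {f : E → ℝ} (hf : ConvexOn ℝ Set.univ f) {g x : E}
    (hg : HasGradientAt f g x) (y : E) : ⟪g, y - x⟫ ≤ f y - f x := by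
  have hline : HasDerivAt (f ∘ AffineMap.lineMap (k := ℝ) x y) ⟪g, y - x⟫ 0 := by
    have hg' : HasFDerivAt f (InnerProductSpace.toDual ℝ E g)
        (AffineMap.lineMap x y (0 : ℝ)) := by
      simpa using hg.hasFDerivAt
    simpa using hg'.comp_hasDerivAt (0 : ℝ) AffineMap.hasDerivAt_lineMap
  have hconv : ConvexOn ℝ Set.univ (f ∘ AffineMap.lineMap (k := ℝ) x y) := by
    simpa using hf.comp_affineMap (AffineMap.lineMap (k := ℝ) x y)
  have h := hconv.le_slope_of_hasDerivAt (Set.mem_univ (0 : ℝ)) (Set.mem_univ (1 : ℝ))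
    one_pos hline
  simpa [slope_def_field] using h

/-- The variational inequality for the projection onto a convex set. -/
theorem IsProjOn.inner_le_zero {E : Type*} [NormedAddCommGroup E] [InnerProductSpace ℝ E]
    {C : Set E} (hC : Convex ℝ C) {y p : E} (h : IsProjOn C y p) {z : E} (hz : z ∈ C) :
    ⟪y - p, z - p⟫ ≤ 0 := by
  have : Nonempty C := ⟨⟨p, h.1⟩⟩
  refine (norm_eq_iInf_iff_real_inner_le_zero hC h.1).1 (le_antisymm ?_ ?_) z hz
  · refine le_ciInf fun w => ?_
    simpa only [norm_sub_rev y] using h.2 w w.2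
  · exact ciInf_le ⟨0, by rintro _ ⟨w, rfl⟩; exact norm_nonneg _⟩ (⟨p, h.1⟩ : C)

/-- Projecting onto a convex set does not increase the distance to points of that set. -/
theorem IsProjOn.norm_sub_sq_le {E : Type*} [NormedAddCommGroup E] [InnerProductSpace ℝ E]
    {C : Set E} (hC : Convex ℝ C) {y p : E} (h : IsProjOn C y p) {z : E} (hz : z ∈ C) :
    ‖p - z‖ ^ 2 ≤ ‖y - z‖ ^ 2 := by
  have hinner := h.inner_le_zero hC hz
  have hexp := norm_sub_sq_real (y - p) (z - p)
  rw [sub_sub_sub_cancel_right] at hexp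
  rw [norm_sub_rev p z]
  nlinarith [sq_nonneg ‖y - p‖]

/-- One step of projected gradient descent. -/
theorem IsProjOn.two_mul_inner_le {E : Type*} [NormedAddCommGroup E] [InnerProductSpace ℝ E]
    {C : Set E} (hC : Convex ℝ C) {η : ℝ} {x g p z : E} (h : IsProjOn C (x - η • g) p)
    (hz : z ∈ C) :
    2 * η * ⟪g, x - z⟫ ≤ ‖x - z‖ ^ 2 - ‖p - z‖ ^ 2 + η ^ 2 * ‖g‖ ^ 2 := by
  have hle := h.norm_sub_sq_le hC hz
  have hexp := norm_sub_sq_real (x - z) (η • g)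
  rw [inner_smul_right, real_inner_comm, norm_smul, mul_pow, Real.norm_eq_abs, sq_abs,
    sub_right_comm] at hexp
  linarith

/-- One step of gradient ascent projected onto the nonnegative half-line. -/
theorem two_mul_mul_sub_le_of_eq_max {η a g b c : ℝ} (hb : b = max 0 (a + η * g)) (hc : 0 ≤ c) :
    2 * η * (g * (c - a)) ≤ (a - c) ^ 2 - (b - c) ^ 2 + η ^ 2 * g ^ 2 := by
  rcases max_cases 0 (a + η * g) with ⟨h, h'⟩ | ⟨h, h'⟩ <;> rw [h] at hb <;> subst hb <;> nlinarith

/-- Lemma 4 of the paper, bandit setting.  For the convex-concave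
surrogates `H_t` built from `L̂_t(x,λ) = f_t(x) + λĝ(x) − (ηδ/2)λ²` and the bandit update
directions `g̃_{x,t}`, `g̃_{λ,t}`, the primal-dual iterates projected onto `(1−ξ)B`
satisfy the cumulative gap bound. -/
theorem stmt15 {dd T : ℕ} (R G D η δ ξ : ℝ)
    (hR : 0 < R) (hG : 0 < G) (hD : 0 < D) (hη : 0 < η) (hδ : 0 < δ)
    (hξ0 : 0 < ξ) (hξ1 : ξ < 1)
    (f : ℕ → EuclideanSpace ℝ (Fin dd) → ℝ)
    (hfconv : ∀ t, ConvexOn ℝ Set.univ (f t))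
    (gf : ℕ → EuclideanSpace ℝ (Fin dd) → EuclideanSpace ℝ (Fin dd))
    (hgf : ∀ t x, HasGradientAt (f t) (gf t x) x)
    (hgfB : ∀ t, ∀ x ∈ Metric.closedBall (0 : EuclideanSpace ℝ (Fin dd)) R, ‖gf t x‖ ≤ G)
    (gh : EuclideanSpace ℝ (Fin dd) → ℝ)
    (hghconv : ConvexOn ℝ Set.univ gh)
    (ggh : EuclideanSpace ℝ (Fin dd) → EuclideanSpace ℝ (Fin dd))
    (hggh : ∀ x, HasGradientAt gh (ggh x) x)
    (hgghB : ∀ x ∈ Metric.closedBall (0 : EuclideanSpace ℝ (Fin dd)) R, ‖ggh x‖ ≤ G)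
    (hghB : ∀ x ∈ Metric.closedBall (0 : EuclideanSpace ℝ (Fin dd)) R, |gh x| ≤ D)
    -- iterates and bandit update directions
    (x : ℕ → EuclideanSpace ℝ (Fin dd)) (lam : ℕ → ℝ)
    (gx : ℕ → EuclideanSpace ℝ (Fin dd)) (gl : ℕ → ℝ)
    (hx1 : x 1 = 0) (hlam1 : lam 1 = 0)
    (hxupd : ∀ t, 1 ≤ t →
      IsProjOn (Metric.closedBall (0 : EuclideanSpace ℝ (Fin dd)) ((1 - ξ) * R))
        (x t - η • gx t) (x (t + 1)))
    (hlamupd : ∀ t, 1 ≤ t → lam (t + 1) = max 0 (lam t + η * gl t))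
    (hgxbound : ∀ t, 1 ≤ t → ‖gx t - gf t (x t)‖ ≤ G * dd * lam t)
    (hglbound : ∀ t, 1 ≤ t → |gl t + η * δ * lam t| ≤ D)
    -- the convex-concave surrogates `H_t`
    (H : ℕ → EuclideanSpace ℝ (Fin dd) → ℝ → ℝ)
    (hHdef : ∀ t xx lam', H t xx lam' =
      (f t xx + lam' * gh xx - η * δ / 2 * lam' ^ 2)
        + ⟪gx t - (gf t (x t) + lam t • ggh (x t)), xx⟫
        + (gl t - (gh (x t) - η * δ * lam t)) * lam') :
    ∀ xx : EuclideanSpace ℝ (Fin dd), ‖xx‖ ≤ (1 - ξ) * R →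
      ∀ lam' : ℝ, 0 ≤ lam' →
      ∑ t ∈ Finset.Icc 1 T, (H t (x t) lam' - H t xx (lam t))
        ≤ (R ^ 2 + lam' ^ 2) / (2 * η) + η * (D ^ 2 + G ^ 2) * T
          + η * ((dd : ℝ) ^ 2 * G ^ 2 + η ^ 2 * δ ^ 2)
            * ∑ t ∈ Finset.Icc 1 T, lam t ^ 2 := by
  intro xx hxx lam' hlam'
  have hball : Convex ℝ (Metric.closedBall (0 : EuclideanSpace ℝ (Fin dd)) ((1 - ξ) * R)) :=
    convex_closedBall _ _
  have hxxmem : xx ∈ Metric.closedBall (0 : EuclideanSpace ℝ (Fin dd)) ((1 - ξ) * R) := by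
    simpa using hxx
  have hrad : (1 - ξ) * R ≤ R := by nlinarith
  have hlam_nonneg : ∀ t, 1 ≤ t → 0 ≤ lam t := by
    intro t ht
    induction t, ht using Nat.le_induction with
    | base => exact hlam1.ge
    | succ n hn _ => rw [hlamupd n hn]; exact le_max_left _ _
  have hxmem : ∀ t, 1 ≤ t → x t ∈ Metric.closedBall (0 : EuclideanSpace ℝ (Fin dd)) R := by
    intro t ht
    induction t, ht using Nat.le_induction with
    | base => rw [hx1]; exact Metric.mem_closedBall_self hR.le
    | succ n hn _ => exact Metric.closedBall_subset_closedBall hrad (hxupd n hn).1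
  have hgap : ∀ t, 1 ≤ t → H t (x t) lam' - H t xx (lam t)
      ≤ ⟪gx t, x t - xx⟫ + gl t * (lam' - lam t) := by
    intro t ht
    have hf := (hfconv t).inner_gradient_le_sub (hgf t (x t)) xx
    have hg := mul_le_mul_of_nonneg_left (hghconv.inner_gradient_le_sub (hggh (x t)) xx)
      (hlam_nonneg t ht)
    have hquad : 0 ≤ η * δ * (lam' - lam t) ^ 2 := by positivity
    rw [hHdef, hHdef]
    simp only [inner_sub_left, inner_add_left, inner_sub_right, real_inner_smul_left] at hf hg ⊢
    nlinarith
  have hgx : ∀ t, 1 ≤ t → ‖gx t‖ ^ 2 ≤ 2 * (G ^ 2 + (dd : ℝ) ^ 2 * G ^ 2 * lam t ^ 2) := by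
    intro t ht
    have hnorm : ‖gx t‖ ≤ G * dd * lam t + G := by
      have htri := norm_add_le (gx t - gf t (x t)) (gf t (x t))
      rw [sub_add_cancel] at htri
      linarith [hgxbound t ht, hgfB t (x t) (hxmem t ht)]
    have hsq := pow_le_pow_left₀ (norm_nonneg _) hnorm 2
    nlinarith [sq_nonneg (G * dd * lam t - G)]
  have hgl : ∀ t, 1 ≤ t → gl t ^ 2 ≤ 2 * (D ^ 2 + η ^ 2 * δ ^ 2 * lam t ^ 2) := by
    intro t ht
    have hsq := sq_le_sq' (abs_le.1 (hglbound t ht)).1 (abs_le.1 (hglbound t ht)).2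
    nlinarith [sq_nonneg (gl t + 2 * (η * δ * lam t))]
  have hstep : ∀ t, 1 ≤ t → 2 * η * (H t (x t) lam' - H t xx (lam t))
      ≤ (‖x t - xx‖ ^ 2 + (lam t - lam') ^ 2)
        - (‖x (t + 1) - xx‖ ^ 2 + (lam (t + 1) - lam') ^ 2)
        + 2 * η ^ 2 * (D ^ 2 + G ^ 2 + ((dd : ℝ) ^ 2 * G ^ 2 + η ^ 2 * δ ^ 2) * lam t ^ 2) := by
    intro t ht
    have hprimal := (hxupd t ht).two_mul_inner_le hball hxxmem
    have hdual := two_mul_mul_sub_le_of_eq_max (hlamupd t ht) hlam'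
    have hgap' := mul_le_mul_of_nonneg_left (hgap t ht) (by positivity : 0 ≤ 2 * η)
    have hgx' := mul_le_mul_of_nonneg_left (hgx t ht) (sq_nonneg η)
    have hgl' := mul_le_mul_of_nonneg_left (hgl t ht) (sq_nonneg η)
    linarith
  have hsum : ∀ n : ℕ, 2 * η * ∑ t ∈ Finset.Icc 1 n, (H t (x t) lam' - H t xx (lam t))
      ≤ (‖xx‖ ^ 2 + lam' ^ 2) - (‖x (n + 1) - xx‖ ^ 2 + (lam (n + 1) - lam') ^ 2)
        + 2 * η ^ 2 * ((D ^ 2 + G ^ 2) * n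
          + ((dd : ℝ) ^ 2 * G ^ 2 + η ^ 2 * δ ^ 2) * ∑ t ∈ Finset.Icc 1 n, lam t ^ 2) := by
    intro n
    induction n with
    | zero => simp [hx1, hlam1]
    | succ n ih =>
      rw [Finset.sum_Icc_succ_top (by lia), Finset.sum_Icc_succ_top (by lia)]
      have hs := hstep (n + 1) (by lia)
      push_cast
      linarith
  have hxxsq : ‖xx‖ ^ 2 ≤ R ^ 2 := pow_le_pow_left₀ (norm_nonneg _) (hxx.trans hrad) 2
  have htotal := hsum T
  rw [← mul_le_mul_iff_right₀ (by positivity : 0 < 2 * η), mul_add, mul_add,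
    mul_div_cancel₀ _ (by positivity : (2 * η) ≠ 0)]
  nlinarith [sq_nonneg ‖x (T + 1) - xx‖, sq_nonneg (lam (T + 1) - lam')]
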